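/- No primitive element of F_k is strictly minimal; that is, if u ∈ F_k is a cyclically reduced word that belongs to some free basis of F_k, then u ∉ SM. -/

import Mathlib

/-! Common definitions: free group `FG k = F(a_1,…,a_k)`, reduced and cyclically
reduced words, Whitehead automorphisms, strict minimality, counting functions and
exponential genericity, following Kapovich–Schupp–Shpilrain. -/

/-- The free group of rank `k` on the basis `a_1,…,a_k`. -/
abbrev FG (k : ℕ) := FreeGroup (Fin k)

/-- The alphabet `Σ = {a_1,…,a_k}^{±1}`: a letter is a basis index together with a sign. -/
abbrev Letter (k : ℕ) := Fin k × Bool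

/-- The inverse of a letter. -/
def linv {k : ℕ} (x : Letter k) : Letter k := (x.1, !x.2)

/-- The length `|g|` of the reduced word representing `g`. -/
def wordLength {k : ℕ} (g : FG k) : ℕ := (FreeGroup.toWord g).length

/-- A word is (freely) reduced if it equals its free reduction. -/
def ReducedWord {k : ℕ} (w : List (Letter k)) : Prop := FreeGroup.reduce w = w

/-- A word is cyclically reduced if all of its cyclic permutations are reduced;
equivalently, `w ++ w` is reduced. -/
def CyclicallyReducedWord {k : ℕ} (w : List (Letter k)) : Prop :=
  FreeGroup.reduce (w ++ w) = w ++ w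

/-- An element of `FG k` is cyclically reduced if its reduced word is. -/
def IsCyclicallyReduced {k : ℕ} (g : FG k) : Prop :=
  CyclicallyReducedWord (FreeGroup.toWord g)

/-- `C`, the set of all cyclically reduced elements of `FG k`. -/
def Cset (k : ℕ) : Set (FG k) := {g | IsCyclicallyReduced g}

/-- The cyclic length `‖g‖`: the length of the cyclically reduced form of `g`
(the unique cyclically reduced `u` with `g = x u x⁻¹`). -/
noncomputable def cyclicLength {k : ℕ} (g : FG k) : ℕ :=
  sInf {n | ∃ x u : FG k, IsCyclicallyReduced u ∧ g = x * u * x⁻¹ ∧ wordLength u = n}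

/-- The set `Σ = {a_1,…,a_k}^{±1}` inside the free group. -/
def letterSet (k : ℕ) : Set (FG k) :=
  {g | ∃ i : Fin k, g = FreeGroup.of i ∨ g = (FreeGroup.of i)⁻¹}

/-- A Whitehead automorphism of the first kind: a relabeling automorphism,
i.e. one whose restriction to `Σ` is a permutation of `Σ`. -/
def IsRelabeling {k : ℕ} (τ : MulAut (FG k)) : Prop :=
  (⇑τ) '' letterSet k = letterSet k

/-- A Whitehead automorphism of the second kind, with multiplier `a ∈ Σ`:
`τ a = a` and `τ x ∈ {x, xa, a⁻¹x, a⁻¹xa}` for all `x ∈ Σ`. -/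
def IsWhitehead2 {k : ℕ} (τ : MulAut (FG k)) : Prop :=
  ∃ a ∈ letterSet k, τ a = a ∧
    ∀ x ∈ letterSet k, τ x = x ∨ τ x = x * a ∨ τ x = a⁻¹ * x ∨ τ x = a⁻¹ * x * a

/-- An automorphism is inner if it is conjugation by some element. -/
def IsInner {k : ℕ} (α : MulAut (FG k)) : Prop := ∃ g : FG k, α = MulAut.conj g

/-- `SM`: the set of strictly minimal cyclically reduced elements, those `w` with
`‖τ w‖ > |w|` for every non-inner Whitehead automorphism `τ` of the second kind. -/
def SM (k : ℕ) : Set (FG k) :=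
  {w | IsCyclicallyReduced w ∧
    ∀ τ : MulAut (FG k), IsWhitehead2 τ → ¬ IsInner τ → wordLength w < cyclicLength (τ w)}

/-- `SM'`: elements whose cyclically reduced form lies in `SM`. -/
def SM' (k : ℕ) : Set (FG k) := {g | ∃ x u : FG k, u ∈ SM k ∧ g = x * u * x⁻¹}

/-- `γ(n,S)`: the number of elements of `S` of length `n`. -/
noncomputable def gammaC {k : ℕ} (S : Set (FG k)) (n : ℕ) : ℕ :=
  {g ∈ S | wordLength g = n}.ncard

/-- `ρ(n,S)`: the number of elements of `S` of length at most `n`. -/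
noncomputable def rhoC {k : ℕ} (S : Set (FG k)) (n : ℕ) : ℕ :=
  {g ∈ S | wordLength g ≤ n}.ncard

/-- `B ⊆ S` is exponentially generic in `S` if `ρ(n,B)/ρ(n,S) → 1`
exponentially fast. -/
def ExpGenericIn {k : ℕ} (B S : Set (FG k)) : Prop :=
  B ⊆ S ∧ ∃ K : ℝ, 0 < K ∧ ∃ σ : ℝ, 0 < σ ∧ σ < 1 ∧
    ∀ n : ℕ, |1 - (rhoC B n : ℝ) / (rhoC S n : ℝ)| ≤ K * σ ^ n

/-- `B` is exponentially negligible in `S` if `S \ B` is exponentially generic in `S`. -/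
def ExpNegligibleIn {k : ℕ} (B S : Set (FG k)) : Prop := ExpGenericIn (S \ B) S

/-- The orbit `Aut(F_k) w`. -/
def autOrbit {k : ℕ} (w : FG k) : Set (FG k) := {g | ∃ α : MulAut (FG k), α w = g}

/-- `u` is a cyclic permutation of `v`: the reduced word of `u` is a rotation of
the reduced word of `v`. -/
def IsCyclicPerm {k : ℕ} (u v : FG k) : Prop :=
  ∃ n : ℕ, FreeGroup.toWord u = (FreeGroup.toWord v).rotate n

/-- `w` is a proper power: `w = uⁿ` for some `n ≥ 2`. -/
def IsProperPower {k : ℕ} (w : FG k) : Prop := ∃ (u : FG k) (n : ℕ), 2 ≤ n ∧ w = u ^ n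

/-- `TS`: strictly minimal cyclically reduced `w` which are not proper powers and
are not conjugate to `τ w` for any nontrivial relabeling automorphism `τ`. -/
def TS (k : ℕ) : Set (FG k) :=
  {w | w ∈ SM k ∧ ¬ IsProperPower w ∧
    ∀ τ : MulAut (FG k), IsRelabeling τ → τ ≠ 1 → ¬ IsConj (τ w) w}

/-- `TS'`: elements whose cyclically reduced form lies in `TS`. -/
def TS' (k : ℕ) : Set (FG k) := {g | ∃ x u : FG k, u ∈ TS k ∧ g = x * u * x⁻¹}

/-- `Z`: elements of `TS` such that no relabeling automorphism sends `w` to a cyclic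
permutation of `w⁻¹`. -/
def Zset (k : ℕ) : Set (FG k) :=
  {w | w ∈ TS k ∧ ¬ ∃ τ : MulAut (FG k), IsRelabeling τ ∧ IsCyclicPerm (τ w) w⁻¹}

/-- Growth entropy `H(S) = limsup ρ(n,S)^{1/n}`. -/
noncomputable def entropyH {k : ℕ} (S : Set (FG k)) : ℝ :=
  Filter.limsup (fun n : ℕ => (rhoC S n : ℝ) ^ ((n : ℝ)⁻¹)) Filter.atTop

/-- Number of occurrences of the two-letter word `xy` as a subword of `w`. -/
def countPair {k : ℕ} (w : List (Letter k)) (x y : Letter k) : ℕ :=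
  (w.zip w.tail).count (x, y)

/-- The label `ŵ_{xy}` of the edge `[x⁻¹, y]` in the weighted Whitehead graph of the
cyclically reduced word `w`: occurrences of `xy` and of `y⁻¹x⁻¹` in `wc`, where `c` is
the first letter of `w`. -/
def whLabel {k : ℕ} (w : List (Letter k)) (x y : Letter k) : ℕ :=
  countPair (w ++ w.take 1) x y + countPair (w ++ w.take 1) (linv y) (linv x)

/-- The one-relator group `G_u = ⟨a_1,…,a_k ∣ u = 1⟩`. -/
abbrev OneRel (k : ℕ) (u : FG k) := FG k ⧸ Subgroup.normalClosure ({u} : Set (FG k))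

/-- `u` is primitive: it belongs to some free basis of `FG k`, equivalently it is the
image of a basis element under an automorphism. -/
def IsPrimitive {k : ℕ} (u : FG k) : Prop :=
  ∃ (α : MulAut (FG k)) (i : Fin k), α (FreeGroup.of i) = u

section WhiteheadProof

theorem linv_linv' {k : ℕ} (x : Letter k) : linv (linv x) = x := by
  rcases x with ⟨i, b⟩; simp [linv]

theorem linv_ne_self {k : ℕ} (x : Letter k) : linv x ≠ x := by
  rcases x with ⟨i, b⟩; cases b <;> simp [linv]

theorem mk_linv {k : ℕ} (x : Letter k) :
    (FreeGroup.mk [linv x] : FG k) = (FreeGroup.mk [x])⁻¹ := by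
  simp [FreeGroup.inv_mk, FreeGroup.invRev, linv]

theorem eq_or_linv {k : ℕ} {x b : Letter k} (h : x.1 = b.1) : x = b ∨ x = linv b := by
  rcases x with ⟨i, s⟩; rcases b with ⟨j, t⟩
  simp only at h; subst h
  cases s <;> cases t <;> simp [linv]

theorem wordLength_mk_le {k : ℕ} (L : List (Letter k)) :
    wordLength (FreeGroup.mk L : FG k) ≤ L.length := FreeGroup.norm_mk_le

theorem wordLength_mul_le {k : ℕ} (g h : FG k) :
    wordLength (g * h) ≤ wordLength g + wordLength h := FreeGroup.norm_mul_le g h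

theorem append_self_reduced {k : ℕ} {w : List (Letter k)} :
    FreeGroup.IsCyclicallyReduced w ↔ FreeGroup.IsReduced (w ++ w) := by
  rw [FreeGroup.isCyclicallyReduced_iff, FreeGroup.IsReduced, FreeGroup.IsReduced,
    List.isChain_append]
  tauto

theorem cyclicLength_conj_le {k : ℕ} (y g : FG k) :
    cyclicLength g ≤ wordLength (y * g * y⁻¹) := by
  set L := (y * g * y⁻¹).toWord with hL
  have hr : FreeGroup.IsReduced L := FreeGroup.isReduced_toWord
  have h1 := FreeGroup.reduceCyclically.isCyclicallyReduced hr
  have h2 := FreeGroup.reduceCyclically.conj_conjugator_reduceCyclically L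
  set R := FreeGroup.reduceCyclically L
  set C := FreeGroup.reduceCyclically.conjugator L
  have hRw : (FreeGroup.mk R : FG k).toWord = R := h1.isReduced.reduce_eq
  have hlen : wordLength (FreeGroup.mk R : FG k) ≤ wordLength (y * g * y⁻¹) := by
    have := congrArg List.length h2
    simp only [List.length_append] at this
    unfold wordLength
    rw [hRw, ← hL]; omega
  refine le_trans (Nat.sInf_le ?_) hlen
  refine ⟨y⁻¹ * FreeGroup.mk C, FreeGroup.mk R, ?_, ?_, rfl⟩
  · unfold IsCyclicallyReduced CyclicallyReducedWord
    rw [hRw]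
    exact (append_self_reduced.1 h1).reduce_eq
  · have h3 : y * g * y⁻¹ = FreeGroup.mk C * FreeGroup.mk R * (FreeGroup.mk C)⁻¹ := by
      rw [FreeGroup.inv_mk, FreeGroup.mul_mk, FreeGroup.mul_mk, h2, hL, FreeGroup.mk_toWord]
    calc g = y⁻¹ * (y * g * y⁻¹) * y := by group
      _ = _ := by rw [h3]; group

/-- Pairs of consecutive letters compatible with a cut vertex. -/
def GoodPair {k : ℕ} (b : Letter k) (ε : Letter k → Bool) (x y : Letter k) : Prop :=
  linv x ≠ y ∧ (linv x ≠ b → y ≠ b → ε (linv x) = ε y)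

noncomputable def wE {k : ℕ} (b : Letter k) (ε : Letter k → Bool) (x : Letter k) : FG k :=
  if x.1 ≠ b.1 ∧ ε x = true then (FreeGroup.mk [b])⁻¹ else 1

noncomputable def wHom {k : ℕ} (e : Letter k → FG k) : FG k →* FG k :=
  FreeGroup.lift fun i => (e (i, true))⁻¹ * FreeGroup.of i * e (i, false)

theorem wHom_letter {k : ℕ} (e : Letter k → FG k) (x : Letter k) :
    wHom e (FreeGroup.mk [x]) = (e x)⁻¹ * FreeGroup.mk [x] * e (linv x) := by
  have h : ∀ i, wHom e (FreeGroup.mk [(i, true)])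
      = (e (i, true))⁻¹ * FreeGroup.mk [(i, true)] * e (i, false) := by
    intro i
    exact FreeGroup.lift_apply_of
  rcases x with ⟨i, s⟩
  cases s
  · have := mk_linv ((i, true) : Letter k)
    simp only [linv, Bool.not_true] at this
    simp only [linv, Bool.not_false, this, map_inv, h]
    group
  · exact h i

theorem wE_fix {k : ℕ} (b : Letter k) (ε : Letter k → Bool) {x : Letter k} (h : x.1 = b.1) :
    wE b ε x = 1 := by simp [wE, h]

theorem wHom_b {k : ℕ} (b : Letter k) (e : Letter k → FG k)
    (h : ∀ x : Letter k, x.1 = b.1 → e x = 1) :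
    wHom e (FreeGroup.mk [b]) = FreeGroup.mk [b] := by
  rw [wHom_letter, h b rfl, h (linv b) rfl]; simp

theorem wHom_comp {k : ℕ} (e e' : Letter k → FG k)
    (hE : ∀ x, wHom e' (e x) = e x) (hinv : ∀ x, e' x = (e x)⁻¹) (g : FG k) :
    wHom e' (wHom e g) = g := by
  have : (wHom e').comp (wHom e) = MonoidHom.id _ := by
    ext i
    have h1 := wHom_letter e (i, true)
    have h2 := wHom_letter e' (i, true)
    simp only [MonoidHom.comp_apply, MonoidHom.id_apply]
    change wHom e' (wHom e (FreeGroup.mk [(i, true)])) = FreeGroup.mk [(i, true)]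
    rw [h1, map_mul, map_mul, map_inv, hE, hE, h2, hinv, hinv]
    group
  exact DFunLike.congr_fun this g

noncomputable def wAut {k : ℕ} (b : Letter k) (ε : Letter k → Bool) : MulAut (FG k) :=
  { wHom (wE b ε) with
    invFun := wHom (fun x => (wE b ε x)⁻¹)
    left_inv := by
      intro g
      refine wHom_comp (wE b ε) _ ?_ (fun _ => rfl) g
      intro x
      have := wHom_b b (fun x => (wE b ε x)⁻¹) (fun x hx => by simp [wE_fix b ε hx])
      unfold wE at this ⊢
      split_ifs
      · rw [map_inv, this]
      · simp
    right_inv := by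
      intro g
      refine wHom_comp (fun x => (wE b ε x)⁻¹) _ ?_ (fun _ => by simp) g
      intro x
      have := wHom_b b (wE b ε) (fun x hx => by simp [wE_fix b ε hx])
      rw [map_inv]
      congr 1
      unfold wE at this ⊢
      split_ifs
      · rw [map_inv, this]
      · simp }

theorem wAut_letter {k : ℕ} (b : Letter k) (ε : Letter k → Bool) (x : Letter k) :
    wAut b ε (FreeGroup.mk [x]) = (wE b ε x)⁻¹ * FreeGroup.mk [x] * wE b ε (linv x) :=
  wHom_letter _ x

theorem mem_letterSet {k : ℕ} {g : FG k} :
    g ∈ letterSet k ↔ ∃ x : Letter k, g = FreeGroup.mk [x] := by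
  constructor
  · rintro ⟨i, rfl | rfl⟩
    · exact ⟨(i, true), rfl⟩
    · exact ⟨(i, false), rfl⟩
  · rintro ⟨⟨i, s⟩, rfl⟩
    cases s
    · exact ⟨i, Or.inr rfl⟩
    · exact ⟨i, Or.inl rfl⟩

theorem wAut_whitehead {k : ℕ} (b : Letter k) (ε : Letter k → Bool) :
    IsWhitehead2 (wAut b ε) := by
  refine ⟨(FreeGroup.mk [b])⁻¹, mem_letterSet.2 ⟨linv b, (mk_linv b).symm⟩, ?_, ?_⟩
  · rw [map_inv, wAut_letter, wE_fix b ε (x := b) rfl, wE_fix b ε (x := linv b) rfl]; simp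
  · intro g hg
    obtain ⟨x, rfl⟩ := mem_letterSet.1 hg
    rw [wAut_letter]
    unfold wE
    split_ifs <;> simp

noncomputable def wQ {k : ℕ} (b : Letter k) (ε : Letter k → Bool) (x y : Letter k) : FG k :=
  if y = b then wE b ε (linv x) else wE b ε y

theorem wQ_step {k : ℕ} (b : Letter k) (ε : Letter k → Bool) (hb : ε (linv b) = false)
    (x y z : Letter k) (h1 : GoodPair b ε x y) (h2 : GoodPair b ε y z) :
    wordLength (wQ b ε x y * wAut b ε (FreeGroup.mk [y]) * (wQ b ε y z)⁻¹) ≤ 1 := by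
  have one : ∀ y : Letter k, wordLength (FreeGroup.mk [y] : FG k) ≤ 1 :=
    fun y => wordLength_mk_le [y]
  have zero : wordLength (1 : FG k) ≤ 1 := by simp [wordLength]
  rw [wAut_letter]
  by_cases hy : y.1 = b.1
  · rw [wE_fix b ε hy, wE_fix b ε (x := linv y) hy]
    rcases eq_or_linv hy with rfl | rfl
    · have hz : wQ y ε y z = 1 := by
        unfold wQ
        split_ifs with hzb
        · exact wE_fix _ _ rfl
        · have := h2.2 (linv_ne_self y) hzb
          unfold wE
          rw [if_neg]
          rw [← this, hb]; simp
      rw [hz]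
      unfold wQ
      rw [if_pos rfl]
      unfold wE
      split_ifs
      · simpa [-FreeGroup.inv_mk] using zero
      · simpa using one y
    · have hxy : wQ b ε x (linv b) = 1 := by
        unfold wQ
        rw [if_neg (linv_ne_self b)]
        exact wE_fix _ _ rfl
      have hzb : z ≠ b := by
        have := h2.1
        rw [linv_linv'] at this
        exact this.symm
      rw [hxy]
      unfold wQ
      rw [if_neg hzb]
      unfold wE
      rw [mk_linv]
      split_ifs
      · simpa [-FreeGroup.inv_mk] using zero
      · have := one (linv b)
        rw [mk_linv] at this
        simpa [-FreeGroup.inv_mk] using this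
  · have hyb : y ≠ b := fun h => hy (by rw [h])
    have hlb : linv y ≠ b := fun h => hy (by rw [← h]; rfl)
    have hq1 : wQ b ε x y = wE b ε y := by unfold wQ; rw [if_neg hyb]
    have hq2 : wQ b ε y z = wE b ε (linv y) := by
      unfold wQ
      split_ifs with hzb
      · rfl
      · have := h2.2 hlb hzb
        by_cases hz1 : z.1 = b.1
        · have hz2 : z = linv b := (eq_or_linv hz1).resolve_left hzb
          rw [wE_fix b ε hz1]
          unfold wE
          rw [if_neg]
          rw [this, hz2, hb]; simp
        · unfold wE
          have hl1 : (linv y).1 ≠ b.1 := hy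
          simp [hz1, hl1, this]
    rw [hq1, hq2]
    have := one y
    convert this using 2
    group

theorem wQ_path {k : ℕ} (b : Letter k) (ε : Letter k → Bool) (hb : ε (linv b) = false)
    (L : List (Letter k)) : ∀ (p z : Letter k), List.IsChain (GoodPair b ε) (p :: (L ++ [z])) →
    ∃ r, ((L = [] ∧ r = wQ b ε p z) ∨ ∃ l ∈ L.head?, r = wQ b ε p l) ∧
    wordLength (r * wAut b ε (FreeGroup.mk L) *
      (wQ b ε ((p :: L).getLast (by simp)) z)⁻¹) ≤ L.length := by
  induction L with
  | nil =>
    intro p z h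
    refine ⟨_, Or.inl ⟨rfl, rfl⟩, ?_⟩
    rw [← FreeGroup.one_eq_mk]
    simp [wordLength]
  | cons x L ih =>
    intro p z h
    rw [List.cons_append, List.isChain_cons_cons] at h
    obtain ⟨r, hr, hlen⟩ := ih x z h.2
    refine ⟨_, Or.inr ⟨x, rfl, rfl⟩, ?_⟩
    have key : wordLength (wQ b ε p x * wAut b ε (FreeGroup.mk [x]) * r⁻¹) ≤ 1 := by
      rcases hr with ⟨rfl, rfl⟩ | ⟨l, hl, rfl⟩
      · refine wQ_step b ε hb p x z h.1 ?_
        have := h.2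
        simpa using this
      · refine wQ_step b ε hb p x l h.1 ?_
        rcases L with _ | ⟨l', L⟩
        · simp at hl
        · simp at hl; subst hl
          have := h.2
          rw [List.cons_append, List.isChain_cons_cons] at this
          exact this.1
    have hsplit : (FreeGroup.mk (x :: L) : FG k) = FreeGroup.mk [x] * FreeGroup.mk L := by
      rw [FreeGroup.mul_mk]; rfl
    rw [hsplit, List.getLast_cons (by simp), List.length_cons]
    have := wordLength_mul_le _ _ |>.trans (add_le_add key hlen)
    rw [map_mul]
    have e : wQ b ε p x * (wAut b ε (FreeGroup.mk [x]) * wAut b ε (FreeGroup.mk L)) *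
        (wQ b ε ((x :: L).getLast (by simp)) z)⁻¹ =
        (wQ b ε p x * wAut b ε (FreeGroup.mk [x]) * r⁻¹) * (r * wAut b ε (FreeGroup.mk L) *
          (wQ b ε ((x :: L).getLast (by simp)) z)⁻¹) := by group
    rw [e]
    omega

theorem wAut_length {k : ℕ} (b : Letter k) (ε : Letter k → Bool) (hb : ε (linv b) = false)
    (w : List (Letter k)) (h : List.IsChain (GoodPair b ε) (w ++ w)) :
    cyclicLength (wAut b ε (FreeGroup.mk w)) ≤ w.length := by
  rcases w with _ | ⟨z, w'⟩
  · refine (cyclicLength_conj_le 1 _).trans ?_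
    rw [← FreeGroup.one_eq_mk]
    simp [wordLength]
  · set w := z :: w' with hw
    have hne : w ≠ [] := by simp [hw]
    have hch : List.IsChain (GoodPair b ε) (w.getLast hne :: (w ++ [z])) := by
      have h3 := List.isChain_append.1 h
      have hlast : w.getLast hne ∈ w.getLast? := by simp [List.getLast?_eq_getLast_of_ne_nil hne]
      have hg : GoodPair b ε (w.getLast hne) z := h3.2.2 _ hlast z (by simp [hw])
      rw [List.isChain_cons]
      refine ⟨?_, ?_⟩
      · intro y hy
        simp [hw] at hy
        subst hy; exact hg
      · rw [List.isChain_append]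
        refine ⟨h3.1, by simp, ?_⟩
        intro x hx y hy
        simp at hy; subst hy
        exact h3.2.2 x hx _ (by simp [hw])
    obtain ⟨r, hr, hlen⟩ := wQ_path b ε hb w _ z hch
    have hr' : r = wQ b ε (w.getLast hne) z := by
      rcases hr with ⟨h0, _⟩ | ⟨l, hl, rfl⟩
      · exact absurd h0 hne
      · simp [hw] at hl
        rw [hl]
    rw [List.getLast_cons hne, ← hr'] at hlen
    exact (cyclicLength_conj_le r _).trans hlen

theorem wAut_not_inner {k : ℕ} (b : Letter k) (ε : Letter k → Bool)
    (h1 : ∃ x : Letter k, x.1 ≠ b.1 ∧ ε x = true) (h2 : ∃ x : Letter k, x.1 ≠ b.1 ∧ ε x = false) :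
    ¬ IsInner (wAut b ε) := by
  rintro ⟨g, hg⟩
  have hconj : ∀ x, wAut b ε x = g * x * g⁻¹ := fun x => by rw [hg]; rfl
  have hsym : ∀ x : Letter k, x.1 ≠ b.1 → ε (linv x) = ε x := by
    intro x hx
    let φ : FG k →* Multiplicative ℤ :=
      FreeGroup.lift fun i => if i = b.1 then Multiplicative.ofAdd 1 else 1
    have hb : φ (FreeGroup.mk [b]) ≠ 1 := by
      have h0 : φ (FreeGroup.of b.1) ≠ 1 := by
        simp only [φ, FreeGroup.lift_apply_of, if_true]; decide
      rcases b with ⟨i, s⟩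
      cases s
      · intro h
        apply h0
        change φ ((FreeGroup.of i)⁻¹) = 1 at h
        rwa [map_inv, inv_eq_one] at h
      · exact h0
    have h := congrArg φ (hconj (FreeGroup.mk [x]))
    rw [wAut_letter] at h
    simp only [map_mul, map_inv] at h
    have h' : φ (wE b ε x) = φ (wE b ε (linv x)) := by
      rw [mul_right_comm, mul_right_comm (φ g), mul_inv_cancel, one_mul] at h
      rw [← inv_mul_eq_one]
      exact mul_eq_right.1 h
    unfold wE at h'
    have hl1 : (linv x).1 ≠ b.1 := hx
    cases e1 : ε x <;> cases e2 : ε (linv x) <;> simp [-FreeGroup.inv_mk, hx, hl1, e1, e2] at h' ⊢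
    · exact hb h'
    · exact hb h'
  have toTrue : ∀ x : Letter k, x.1 ≠ b.1 → ε (x.1, true) = ε x := by
    rintro ⟨i, s⟩ hx
    cases s
    · exact hsym (i, false) hx
    · rfl
  obtain ⟨x, hx, hxe⟩ := h1
  obtain ⟨y, hy, hye⟩ := h2
  rw [← toTrue x hx] at hxe
  rw [← toTrue y hy] at hye
  set i := x.1
  set j := y.1
  have hij : i ≠ j := by intro h; rw [h, hye] at hxe; simp at hxe
  let φ : FG k →* Equiv.Perm (Fin 3) :=
    FreeGroup.lift fun l => if l = b.1 then finRotate 3 else Equiv.swap 0 1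
  have hφb : φ (FreeGroup.mk [b]) = finRotate 3 ∨ φ (FreeGroup.mk [b]) = (finRotate 3)⁻¹ := by
    have h0 : φ (FreeGroup.of b.1) = finRotate 3 := by
      simp only [φ, FreeGroup.lift_apply_of, if_true]
    rcases b with ⟨l, s⟩
    cases s
    · right
      change φ ((FreeGroup.of l)⁻¹) = _
      rw [map_inv, h0]
    · exact Or.inl h0
  have hφi : φ (FreeGroup.mk [(i, true)]) = Equiv.swap 0 1 := by
    change φ (FreeGroup.of i) = _
    simp only [φ, FreeGroup.lift_apply_of, if_neg hx]
  have hφj : φ (FreeGroup.mk [(j, true)]) = Equiv.swap 0 1 := by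
    change φ (FreeGroup.of j) = _
    simp only [φ, FreeGroup.lift_apply_of, if_neg hy]
  have ei := hconj (FreeGroup.mk [(i, true)])
  have ej := hconj (FreeGroup.mk [(j, true)])
  have si := hsym (i, true) hx
  have sj := hsym (j, true) hy
  have pi : wE b ε (i, true) = (FreeGroup.mk [b])⁻¹ := by simp [wE, hx, hxe]
  have pi' : wE b ε (linv (i, true)) = (FreeGroup.mk [b])⁻¹ := by
    have : (linv (i, true)).1 ≠ b.1 := hx
    simp [wE, this, si, hxe]
  have pj : wE b ε (j, true) = 1 := by simp [wE, hye]
  have pj' : wE b ε (linv (j, true)) = 1 := by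
    simp [wE, sj, hye]
  rw [wAut_letter, pi, pi'] at ei
  rw [wAut_letter, pj, pj'] at ej
  have fi := congrArg φ ei
  have fj := congrArg φ ej
  simp only [map_mul, map_inv, map_one, hφi, hφj] at fi fj
  generalize φ g = G at fi fj
  rcases hφb with h | h <;> rw [h] at fi <;> revert fi fj <;> revert G <;> decide

theorem lemmaA {k : ℕ} (b : Letter k) (ε : Letter k → Bool) (hb : ε (linv b) = false)
    (h1 : ∃ x : Letter k, x.1 ≠ b.1 ∧ ε x = true) (h2 : ∃ x : Letter k, x.1 ≠ b.1 ∧ ε x = false)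
    (u : FG k) (h : List.IsChain (GoodPair b ε) (u.toWord ++ u.toWord)) : u ∉ SM k := by
  intro hu
  have := hu.2 _ (wAut_whitehead b ε) (wAut_not_inner b ε h1 h2)
  have h3 := wAut_length b ε hb _ h
  rw [FreeGroup.mk_toWord] at h3
  unfold wordLength at this
  omega

theorem chain_spread {k : ℕ} (P : Letter k → Prop) (w : List (Letter k))
    (h : List.IsChain (fun x y => P x → P y) (w ++ w)) (z : Letter k) (hz : z ∈ w) (hP : P z) :
    ∀ y ∈ w, P y := by
  obtain ⟨l1, l2, rfl⟩ := List.append_of_mem hz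
  have h2 : List.IsChain (fun x y => P x → P y) (z :: (l2 ++ (l1 ++ z :: l2))) :=
    h.suffix ⟨l1, by simp⟩
  have key : ∀ (L : List (Letter k)) (z : Letter k), P z →
      List.IsChain (fun x y => P x → P y) (z :: L) → ∀ y ∈ L, P y := by
    intro L
    induction L with
    | nil => simp
    | cons a L ih =>
      intro z hz hc y hy
      rw [List.isChain_cons_cons] at hc
      have ha := hc.1 hz
      rcases List.mem_cons.1 hy with rfl | hy
      · exact ha
      · exact ih a ha hc.2 y hy
  intro y hy
  exact key _ z hP h2 y (List.mem_append_right _ hy)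

theorem lemmaB {k : ℕ} (hk : 2 ≤ k) (b : Letter k) (ε : Letter k → Bool)
    (h1 : ∃ x : Letter k, x ≠ b ∧ ε x = true) (h2 : ∃ x : Letter k, x ≠ b ∧ ε x = false)
    (u : FG k) (h : List.IsChain (GoodPair b ε) (u.toWord ++ u.toWord)) : u ∉ SM k := by
  have main : ∀ ε : Letter k → Bool, ε (linv b) = false → (∃ x : Letter k, x ≠ b ∧ ε x = true) →
      List.IsChain (GoodPair b ε) (u.toWord ++ u.toWord) → u ∉ SM k := by
    clear h1 h2 h ε
    intro ε hb ⟨x0, hx0, hx0e⟩ h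
    have hx1 : x0.1 ≠ b.1 := by
      intro hh
      rcases eq_or_linv hh with h' | h'
      · exact hx0 h'
      · rw [h', hb] at hx0e; simp at hx0e
    by_cases hy : ∃ y : Letter k, y.1 ≠ b.1 ∧ ε y = false
    · exact lemmaA b ε hb ⟨x0, hx1, hx0e⟩ hy u h
    have hy' : ∀ y : Letter k, ε y = false → y.1 = b.1 := by
      intro y hye
      by_contra hne
      exact hy ⟨y, hne, hye⟩
    set w := u.toWord with hw
    have c1 : List.IsChain (fun x y => x = b → y = b) (w ++ w) := by
      refine h.imp ?_
      rintro x y ⟨hxy, hg⟩ rfl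
      by_contra hyx
      have := hg (linv_ne_self x) hyx
      rw [hb] at this
      rcases eq_or_linv (hy' y this.symm) with h' | h'
      · exact hyx h'
      · exact hxy h'.symm
    have c2 : List.IsChain (fun x y => x ≠ linv b → y ≠ linv b) (w ++ w) := by
      refine h.imp ?_
      rintro x y ⟨hxy, hg⟩ hx rfl
      have hlx : linv x ≠ b := by
        intro h'; apply hx; rw [← h', linv_linv']
      have := hg hlx (linv_ne_self b)
      rw [hb] at this
      rcases eq_or_linv (hy' _ this) with h' | h'
      · exact hlx h'
      · exact hxy h'
    obtain ⟨d, hd⟩ : ∃ d : Fin k, d ≠ b.1 := ⟨x0.1, hx1⟩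
    by_cases hin : ∃ z ∈ w, z.1 = b.1
    · have hall : ∀ z ∈ w, z.1 = b.1 := by
        obtain ⟨z, hz, hzb⟩ := hin
        rcases eq_or_linv hzb with rfl | rfl
        · intro y hy
          rw [chain_spread (· = z) w c1 z hz rfl y hy]
        · intro y hy
          by_contra hne
          have hyb : y ≠ linv b := by rintro rfl; exact hne rfl
          exact chain_spread (· ≠ linv b) w c2 y hy hyb _ hz rfl
      refine lemmaA b (fun x => decide (x = (d, true))) ?_ ⟨(d, true), hd, by simp⟩
        ⟨(d, false), hd, by simp⟩ u ?_
      · simp only [decide_eq_false_iff_not]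
        intro h'
        exact hd (congrArg Prod.fst h').symm
      · refine h.imp_of_mem_imp ?_
        intro x y hx hy hg
        refine ⟨hg.1, fun _ _ => ?_⟩
        have ex : x.1 = b.1 := hall x (by simpa using hx)
        have ey : y.1 = b.1 := hall y (by simpa using hy)
        have e1 : linv x ≠ (d, true) := by
          intro h'; exact hd ((congrArg Prod.fst h').symm.trans ex)
        have e2 : y ≠ (d, true) := by
          intro h'; exact hd ((congrArg Prod.fst h').symm.trans ey)
        simp [e1, e2]
    · have hall : ∀ z ∈ w, z.1 ≠ b.1 := fun z hz hzb => hin ⟨z, hz, hzb⟩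
      refine lemmaA (d, true) (fun x => decide (x = b)) ?_ ⟨b, hd.symm, by simp⟩
        ⟨linv b, hd.symm, by simp [linv_ne_self]⟩ u ?_
      · simp only [decide_eq_false_iff_not]
        intro h'
        exact hd (congrArg Prod.fst h')
      · refine h.imp_of_mem_imp ?_
        intro x y hx hy hg
        refine ⟨hg.1, fun _ _ => ?_⟩
        have ex : x.1 ≠ b.1 := hall x (by simpa using hx)
        have ey : y.1 ≠ b.1 := hall y (by simpa using hy)
        have e1 : linv x ≠ b := by
          intro h'; apply ex; rw [← h']; rfl
        have e2 : y ≠ b := by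
          intro h'; exact ey (congrArg Prod.fst h')
        simp [e1, e2]
  cases hb : ε (linv b)
  · exact main ε hb h1 h
  · refine main (fun x => !(ε x)) (by simp [hb]) ?_ ?_
    · simpa using h2
    · refine h.imp ?_
      intro x y hg
      exact ⟨hg.1, fun a b => by simp [hg.2 a b]⟩

theorem mul_letter {k : ℕ} (g : FG k) (x : Letter k) :
    (g * FreeGroup.mk [x]).toWord = g.toWord ++ [x] ∨
    ∃ L, g.toWord = L ++ [linv x] ∧ (g * FreeGroup.mk [x]).toWord = L := by
  have hr : FreeGroup.IsReduced g.toWord := FreeGroup.isReduced_toWord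
  have hg : FreeGroup.mk g.toWord = g := FreeGroup.mk_toWord
  rcases List.eq_nil_or_concat' g.toWord with h | ⟨L, z, h⟩
  · left
    rw [← hg, h, FreeGroup.mul_mk]
    rfl
  · by_cases hz : z = linv x
    · right
      refine ⟨L, by rw [h, hz], ?_⟩
      have hL : FreeGroup.IsReduced L := by
        rw [h] at hr
        exact List.IsChain.left_of_append hr
      have : g * FreeGroup.mk [x] = FreeGroup.mk L := by
        rw [← hg, h, hz, ← FreeGroup.mul_mk, mk_linv]; simp [-FreeGroup.inv_mk, -FreeGroup.mul_mk]
      rw [this]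
      exact hL.reduce_eq
    · left
      have : FreeGroup.IsReduced (g.toWord ++ [x]) := by
        refine List.isChain_append.2 ⟨hr, by simp, ?_⟩
        intro a ha y hy hay
        simp at hy; subst hy
        rw [h] at ha
        simp at ha; subst ha
        rcases eq_or_linv hay with h' | h'
        · rw [h']
        · exact absurd h' hz
      conv_lhs => rw [← hg, FreeGroup.mul_mk]
      exact this.reduce_eq

noncomputable def c0 {k : ℕ} (j : Fin k) (g : FG k) : Bool :=
  decide (g.toWord.head? = some (j, true))

theorem c0_mul {k : ℕ} (j i : Fin k) (g : FG k) (h : i ≠ j ∨ g ≠ 1) :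
    c0 j (g * FreeGroup.of i) = c0 j g := by
  have h' : i ≠ j ∨ g.toWord ≠ [] := by
    rcases h with h | h
    · exact Or.inl h
    · exact Or.inr (by simpa using h)
  change c0 j (g * FreeGroup.mk [(i, true)]) = _
  unfold c0
  rcases mul_letter g (i, true) with e | ⟨L, e1, e2⟩
  · rw [e]
    rcases hL : g.toWord with _ | ⟨a, L⟩
    · rw [hL] at h'
      simp at h'
      simp [h']
    · simp
  · rw [e2, e1]
    rcases L with _ | ⟨a, L⟩
    · simp [linv]
    · simp

theorem c0_finite {k : ℕ} (j : Fin k) (v : FG k) : {g | c0 j (g * v) ≠ c0 j g}.Finite := by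
  induction v using FreeGroup.induction_on with
  | C1 => simp
  | of i =>
    refine (Set.finite_singleton (1 : FG k)).subset ?_
    intro g hg
    by_contra hne
    exact hg (c0_mul j i g (Or.inr hne))
  | inv_of i hi =>
    refine (hi.preimage (f := fun g => g * (FreeGroup.of i)⁻¹)
      (mul_left_injective _).injOn).subset ?_
    intro g hg
    simp only [Set.mem_preimage, Set.mem_ofPred_eq, inv_mul_cancel_right] at hg ⊢
    exact hg.symm
  | mul x y hx hy =>
    refine (hx.union (hy.preimage (f := fun g => g * x) (mul_left_injective _).injOn)).subset ?_
    intro g hg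
    simp only [Set.mem_union, Set.mem_preimage, Set.mem_ofPred_eq, ← mul_assoc] at hg ⊢
    by_contra hcon
    push Not at hcon
    exact hg (hcon.2.trans hcon.1)

theorem finite_short {k : ℕ} (M : ℕ) : {g : FG k | wordLength g < M}.Finite :=
  (List.finite_length_lt (Letter k) M).preimage FreeGroup.toWord_injective.injOn

theorem exists_c {k : ℕ} (hk : 2 ≤ k) (u : FG k) (hp : IsPrimitive u) :
    ∃ c : FG k → Bool, (∀ g, c (g * u) = c g) ∧ ∃ M : ℕ,
      (∀ g (x : Letter k), M ≤ wordLength g → c (g * FreeGroup.mk [x]) = c g) ∧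
      (∃ g, M ≤ wordLength g ∧ c g = true) ∧ (∃ g, M ≤ wordLength g ∧ c g = false) := by
  obtain ⟨α, i, rfl⟩ := hp
  have : Nontrivial (Fin k) := Fin.nontrivial_iff_two_le.2 hk
  obtain ⟨j, hj⟩ := exists_ne i
  let c : FG k → Bool := fun g => c0 j (α⁻¹ g)
  have hfin : ∀ x : Letter k, {g | c (g * FreeGroup.mk [x]) ≠ c g}.Finite := by
    intro x
    refine ((c0_finite j (α⁻¹ (FreeGroup.mk [x]))).preimage (f := fun g => α⁻¹ g)
      (α⁻¹).injective.injOn).subset ?_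
    intro g hg
    simpa only [c, Set.mem_preimage, Set.mem_ofPred_eq, map_mul] using hg
  have hfin2 : (⋃ x : Letter k, {g | c (g * FreeGroup.mk [x]) ≠ c g}).Finite :=
    Set.finite_iUnion hfin
  obtain ⟨N, hN⟩ := (hfin2.image wordLength).bddAbove
  have hlong : ∀ l : Fin k, ∃ n : ℕ, N + 1 ≤ wordLength (α (FreeGroup.of l ^ (n + 1))) := by
    intro l
    by_contra hcon
    push Not at hcon
    have hinj : Function.Injective (fun n : ℕ => α (FreeGroup.of l ^ (n + 1))) := by
      intro m n hmn
      have := congrArg FreeGroup.norm (α.injective hmn)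
      rw [FreeGroup.norm_of_pow, FreeGroup.norm_of_pow] at this
      omega
    exact Set.infinite_range_of_injective hinj
      ((finite_short (N + 1)).subset (by rintro _ ⟨n, rfl⟩; exact hcon n))
  refine ⟨c, ?_, N + 1, ?_, ?_, ?_⟩
  · intro g
    have : α⁻¹ (α (FreeGroup.of i)) = FreeGroup.of i := by simp
    simp only [c, map_mul, this]
    exact c0_mul j i _ (Or.inl hj.symm)
  · intro g x hg
    by_contra hne
    have := hN ⟨g, Set.mem_iUnion.2 ⟨x, hne⟩, rfl⟩
    omega
  · obtain ⟨n, hn⟩ := hlong j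
    refine ⟨_, hn, ?_⟩
    have : α⁻¹ (α (FreeGroup.of j ^ (n + 1))) = FreeGroup.of j ^ (n + 1) := by simp
    simp only [c, this, c0, FreeGroup.toWord_of_pow]
    simp [List.replicate_succ]
  · obtain ⟨n, hn⟩ := hlong i
    refine ⟨_, hn, ?_⟩
    have : α⁻¹ (α (FreeGroup.of i ^ (n + 1))) = FreeGroup.of i ^ (n + 1) := by simp
    simp only [c, this, c0, FreeGroup.toWord_of_pow]
    simp [List.replicate_succ, hj.symm]

theorem c_const {k : ℕ} (c : FG k → Bool) (M : ℕ)
    (hM : ∀ g (x : Letter k), M ≤ wordLength g → c (g * FreeGroup.mk [x]) = c g)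
    (H : List (Letter k)) (hH : M ≤ H.length) (s : List (Letter k)) :
    FreeGroup.IsReduced (H ++ s) → c (FreeGroup.mk (H ++ s)) = c (FreeGroup.mk H) := by
  induction s using List.reverseRecOn with
  | nil => simp
  | append_singleton s x ih =>
    intro hr
    rw [← List.append_assoc] at hr ⊢
    have hr' : FreeGroup.IsReduced (H ++ s) := List.IsChain.left_of_append hr
    rw [← ih hr', ← FreeGroup.mul_mk]
    apply hM
    unfold wordLength
    rw [FreeGroup.toWord_mk, hr'.reduce_eq]
    simp; omega

theorem reduced_join {k : ℕ} {H t : List (Letter k)} {y : Letter k}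
    (h1 : FreeGroup.IsReduced (H ++ [y])) (h2 : FreeGroup.IsReduced (y :: t)) :
    FreeGroup.IsReduced (H ++ y :: t) := by
  have := FreeGroup.IsReduced.append_overlap (L₁ := H) (L₂ := [y]) (L₃ := t) h1 h2 (by simp)
  simpa using this

theorem reduced_invRev {k : ℕ} {L : List (Letter k)} (h : FreeGroup.IsReduced L) :
    FreeGroup.IsReduced (FreeGroup.invRev L) := by
  rw [FreeGroup.isReduced_iff_reduce_eq, FreeGroup.reduce_invRev, h.reduce_eq]

theorem exists_cut {k : ℕ} (hk : 2 ≤ k) (u : FG k) (hc : IsCyclicallyReduced u)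
    (hp : IsPrimitive u) : ∃ (b : Letter k) (ε : Letter k → Bool),
    (∃ x : Letter k, x ≠ b ∧ ε x = true) ∧ (∃ x : Letter k, x ≠ b ∧ ε x = false) ∧
    List.IsChain (GoodPair b ε) (u.toWord ++ u.toWord) := by
  obtain ⟨c, hcu, M, hM, ⟨gt, hgt, hgt'⟩, ⟨gf, hgf, hgf'⟩⟩ := exists_c hk u hp
  let Mixed : List (Letter k) → Prop := fun H => ∃ s t,
    FreeGroup.IsReduced (H ++ s) ∧ FreeGroup.IsReduced (H ++ t) ∧
    M ≤ (H ++ s).length ∧ M ≤ (H ++ t).length ∧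
    c (FreeGroup.mk (H ++ s)) = true ∧ c (FreeGroup.mk (H ++ t)) = false
  have hM0 : Mixed [] := ⟨gt.toWord, gf.toWord, FreeGroup.isReduced_toWord,
    FreeGroup.isReduced_toWord, hgt, hgf, by simpa [FreeGroup.mk_toWord] using hgt',
    by simpa [FreeGroup.mk_toWord] using hgf'⟩
  have hMlt : ∀ H, Mixed H → H.length < M := by
    rintro H ⟨s, t, hs, ht, -, -, cs, ct⟩
    by_contra hlt
    push Not at hlt
    rw [c_const c M hM H hlt s hs] at cs
    rw [c_const c M hM H hlt t ht, cs] at ct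
    simp at ct
  obtain ⟨H, hH, hmax⟩ : ∃ H, Mixed H ∧ ∀ H', Mixed H' → H'.length ≤ H.length := by
    let S : Set ℕ := {n | ∃ H, Mixed H ∧ H.length = n}
    have hne : S.Nonempty := ⟨_, [], hM0, rfl⟩
    have hbdd : BddAbove S := ⟨M, by rintro _ ⟨H, h, rfl⟩; exact (hMlt H h).le⟩
    obtain ⟨H, hH, hl⟩ := Nat.sSup_mem hne hbdd
    refine ⟨H, hH, fun H' h' => ?_⟩
    rw [hl]
    exact le_csSup hbdd ⟨H', h', rfl⟩
  have htype : ∀ x : Letter k, ∃ v : Bool, ∀ t, FreeGroup.IsReduced (H ++ x :: t) →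
      M ≤ (H ++ x :: t).length → c (FreeGroup.mk (H ++ x :: t)) = v := by
    intro x
    by_contra hcon
    push Not at hcon
    obtain ⟨s, hs, hsM, cs⟩ := hcon false
    obtain ⟨t, ht, htM, ct⟩ := hcon true
    have : Mixed (H ++ [x]) := ⟨s, t, by simpa using hs, by simpa using ht, by simpa using hsM,
      by simpa using htM, by simpa using cs, by simpa using ct⟩
    have := hmax _ this
    simp at this
  choose ε hε using htype
  obtain ⟨x0, hx0, hx0e⟩ : ∃ x, FreeGroup.IsReduced (H ++ [x]) ∧ ε x = true := by
    obtain ⟨s, t, hs, ht, ls, lt, cs, ct⟩ := hH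
    have := hMlt H ⟨s, t, hs, ht, ls, lt, cs, ct⟩
    rcases s with _ | ⟨x, s⟩
    · simp at ls; omega
    · exact ⟨x, List.IsChain.prefix hs ⟨s, by simp⟩, by rw [← hε x s hs ls, cs]⟩
  obtain ⟨y0, hy0, hy0e⟩ : ∃ x, FreeGroup.IsReduced (H ++ [x]) ∧ ε x = false := by
    obtain ⟨s, t, hs, ht, ls, lt, cs, ct⟩ := hH
    have := hMlt H ⟨s, t, hs, ht, ls, lt, cs, ct⟩
    rcases t with _ | ⟨x, t⟩
    · simp at lt; omega
    · exact ⟨x, List.IsChain.prefix ht ⟨t, by simp⟩, by rw [← hε x t ht lt, ct]⟩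
  set w := u.toWord with hw
  have hcr : FreeGroup.IsReduced (w ++ w) := FreeGroup.IsReduced.of_reduce_eq hc
  have hcyc : FreeGroup.IsCyclicallyReduced w := append_self_reduced.2 hcr
  have huw : u = FreeGroup.mk w := FreeGroup.mk_toWord.symm
  have hcpow : ∀ (m : ℕ) g, c (g * u ^ m) = c g := by
    intro m
    induction m with
    | zero => simp
    | succ m ih => intro g; rw [pow_succ, ← mul_assoc, hcu, ih]
  have key : ∀ l1 l2 x y, w ++ w = l1 ++ x :: y :: l2 → FreeGroup.IsReduced (H ++ [linv x]) →
      FreeGroup.IsReduced (H ++ [y]) → ε (linv x) = ε y := by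
    intro l1 l2 x y hsplit hrx hry
    have hwne : w ≠ [] := by
      intro h0; rw [h0] at hsplit; simp at hsplit
    have hwlen : 1 ≤ w.length := by
      rcases w with _ | _
      · simp at hwne
      · simp
    set W := (List.replicate M w).flatten with hW
    have hWlen : M ≤ W.length := by
      simp only [hW, List.length_flatten, List.map_replicate, List.sum_replicate, smul_eq_mul]
      nlinarith
    have hWm : (FreeGroup.mk W : FG k) = u ^ M := by
      rw [huw, FreeGroup.pow_mk]
    have hr1 : FreeGroup.IsReduced (w ++ w ++ W) := by
      have := (hcyc.flatten_replicate (M + 2)).isReduced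
      simpa [List.replicate_succ, hW] using this
    have hr2 : FreeGroup.IsReduced (W ++ (w ++ w)) := by
      have := (hcyc.flatten_replicate (M + 2)).isReduced
      simpa [List.replicate_succ', hW] using this
    rw [hsplit] at hr1 hr2
    have hs1 : FreeGroup.IsReduced (y :: (l2 ++ W)) :=
      List.IsChain.suffix hr1 ⟨l1 ++ [x], by simp⟩
    have hs2 : FreeGroup.IsReduced (W ++ (l1 ++ [x])) :=
      List.IsChain.prefix hr2 ⟨y :: l2, by simp⟩
    have hs3 := reduced_invRev hs2
    have hinv : FreeGroup.invRev (W ++ (l1 ++ [x])) = linv x :: FreeGroup.invRev (W ++ l1) := by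
      simp [FreeGroup.invRev, linv]
    rw [hinv] at hs3
    have v1 := hε y (l2 ++ W) (reduced_join hry hs1) (by simp; omega)
    have v2 := hε (linv x) (FreeGroup.invRev (W ++ l1)) (reduced_join hrx hs3)
      (by simp [FreeGroup.invRev]; omega)
    rw [← v1, ← v2, ← hinv]
    set a : FG k := FreeGroup.mk (l1 ++ [x]) with ha
    have huu : u * u = a * FreeGroup.mk (y :: l2) := by
      rw [huw, FreeGroup.mul_mk, hsplit, ha, FreeGroup.mul_mk]; simp
    have e1 : (FreeGroup.mk (H ++ y :: (l2 ++ W)) : FG k)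
        = FreeGroup.mk H * a⁻¹ * u ^ (M + 2) := by
      have : u ^ (M + 2) = u * u * u ^ M := by rw [← pow_two, ← pow_add, add_comm]
      rw [this, huu, ← hWm]
      have : (FreeGroup.mk (H ++ y :: (l2 ++ W)) : FG k)
        = FreeGroup.mk H * (FreeGroup.mk (y :: l2) * FreeGroup.mk W) := by
        rw [FreeGroup.mul_mk, FreeGroup.mul_mk]; simp
      rw [this]; group
    have e2 : (FreeGroup.mk (H ++ FreeGroup.invRev (W ++ (l1 ++ [x]))) : FG k) * u ^ M
        = FreeGroup.mk H * a⁻¹ * 1 := by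
      rw [← FreeGroup.mul_mk, ← FreeGroup.inv_mk, ← FreeGroup.mul_mk, hWm]
      rw [← ha]
      group
    rw [e1, hcpow, ← hcpow M, e2, mul_one]
  have hnocancel : ∀ l1 l2 x y, w ++ w = l1 ++ x :: y :: l2 → linv x ≠ y := by
    intro l1 l2 x y hsplit hxy
    rw [hsplit] at hcr
    have : FreeGroup.IsReduced [x, y] := List.IsChain.infix hcr ⟨l1, l2, by simp⟩
    subst hxy
    rcases x with ⟨i, s⟩
    simp [FreeGroup.IsReduced, linv] at this
  rcases List.eq_nil_or_concat' H with h0 | ⟨H', d, h0⟩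
  · have hred : ∀ x : Letter k, FreeGroup.IsReduced (H ++ [x]) := by
      intro x; rw [h0]; simp [FreeGroup.IsReduced]
    have hxy0 : x0 ≠ y0 := by rintro rfl; rw [hx0e] at hy0e; simp at hy0e
    obtain ⟨b, hb1, hb2⟩ : ∃ b : Letter k, x0 ≠ b ∧ y0 ≠ b := by
      by_cases h : linv x0 = y0
      · have : Nontrivial (Fin k) := Fin.nontrivial_iff_two_le.2 hk
        obtain ⟨j, hj⟩ := exists_ne x0.1
        refine ⟨(j, true), ?_, ?_⟩
        · intro h'; exact hj (congrArg Prod.fst h').symm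
        · rw [← h]; intro h'; exact hj (congrArg Prod.fst h').symm
      · exact ⟨linv x0, (linv_ne_self x0).symm, fun h' => h h'.symm⟩
    refine ⟨b, ε, ⟨x0, hb1, hx0e⟩, ⟨y0, hb2, hy0e⟩, ?_⟩
    rw [List.isChain_iff_forall_rel_of_append_cons_cons]
    intro x y l1 l2 hl
    exact ⟨hnocancel l1 l2 x y hl, fun _ _ => key l1 l2 x y hl (hred _) (hred _)⟩
  · have hHr : FreeGroup.IsReduced H := List.IsChain.left_of_append hx0
    have hred : ∀ x : Letter k, x ≠ linv d ↔ FreeGroup.IsReduced (H ++ [x]) := by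
      intro x
      have : FreeGroup.IsReduced (H ++ [x]) ↔ (d.1 = x.1 → d.2 = x.2) := by
        unfold FreeGroup.IsReduced at hHr ⊢
        rw [List.isChain_append, h0]
        rw [h0] at hHr
        simp [hHr]
      rw [this]
      rcases x with ⟨i, s⟩
      rcases d with ⟨j, t⟩
      cases s <;> cases t <;> simp [linv, eq_comm]
    refine ⟨linv d, ε, ⟨x0, (hred x0).2 hx0, hx0e⟩, ⟨y0, (hred y0).2 hy0, hy0e⟩, ?_⟩
    rw [List.isChain_iff_forall_rel_of_append_cons_cons]
    intro x y l1 l2 hl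
    exact ⟨hnocancel l1 l2 x y hl,
      fun h1 h2 => key l1 l2 x y hl ((hred _).1 h1) ((hred _).1 h2)⟩

end WhiteheadProof

/-- no primitive element of `F_k` is strictly minimal: a cyclically
reduced primitive element never lies in `SM`. -/
theorem primitive_not_strictly_minimal (k : ℕ) (hk : 2 ≤ k) (u : FG k)
    (hc : IsCyclicallyReduced u) (hp : IsPrimitive u) :
    u ∉ SM k := by
  obtain ⟨b, ε, h1, h2, h⟩ := exists_cut hk u hc hp
  exact lemmaB hk b ε h1 h2 u h
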